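/- Let A be a Noetherian commutative ring. Then the following are equivalent: (i) A is semi-hereditary (every finitely generated ideal is projective); (ii) A is isomorphic to a finite product of Dedekind domains; (iii) A is hereditary (every ideal is projective). -/

import Mathlib

universe u

/-- If `I` is a projective ideal, then to be contained in `I` (for a principal ideal) is to be
divisible by `I`. -/
theorem Ideal.exists_mul_eq_span_singleton_of_projective {R : Type*} [CommRing R] (I : Ideal R)
    [Module.Projective R I] {a : R} (ha : a ∈ I) : ∃ J : Ideal R, I * J = Ideal.span {a} := by
  obtain ⟨s, hs⟩ := Module.projective_def'.mp (inferInstance : Module.Projective R I)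
  refine ⟨Ideal.span (Set.range fun i => s ⟨a, ha⟩ i), le_antisymm ?_ ?_⟩
  · rw [Ideal.mul_le]
    intro x hx y hy
    induction hy using Submodule.span_induction with
    | mem y hy =>
      obtain ⟨i, rfl⟩ := hy
      have h : x • s ⟨a, ha⟩ = a • s ⟨x, hx⟩ := by
        rw [← map_smul, ← map_smul]
        congr 1
        exact Subtype.ext (mul_comm x a)
      have h' := DFunLike.congr_fun h i
      simp only [Finsupp.smul_apply, smul_eq_mul] at h'
      exact Ideal.mem_span_singleton'.mpr ⟨s ⟨x, hx⟩ i, by rw [h', mul_comm]⟩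
    | zero => simp
    | add y z _ _ hy hz => rw [mul_add]; exact add_mem hy hz
    | smul c y _ hy => rw [smul_eq_mul, mul_left_comm]; exact Ideal.mul_mem_left _ _ hy
  · rw [Ideal.span_singleton_le_iff_mem]
    have h := congr_arg Subtype.val (LinearMap.congr_fun hs ⟨a, ha⟩)
    simp only [LinearMap.comp_apply, Finsupp.linearCombination_apply, Finsupp.sum, id,
      LinearMap.id_apply, AddSubmonoidClass.coe_finsetSum] at h
    refine h.subst (motive := (· ∈ _)) (Submodule.sum_mem _ fun i _ => ?_)
    rw [Submodule.coe_smul, smul_eq_mul, mul_comm (s _ i)]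
    exact Ideal.mul_mem_mul i.2 (Ideal.subset_span ⟨i, rfl⟩)

/-- If the principal ideal `(a)` is projective, then the annihilator of `a` is generated by an
idempotent `1 - u`. -/
theorem Ideal.exists_mul_eq_self_of_projective_span_singleton {R : Type*} [CommRing R] (a : R)
    [Module.Projective R (Ideal.span {a})] : ∃ u : R, u * a = a ∧ ∀ x, x * a = 0 → x * u = 0 := by
  let f : R →ₗ[R] Ideal.span {a} :=
    LinearMap.toSpanSingleton R _ ⟨a, Ideal.mem_span_singleton_self a⟩
  have hf : Function.Surjective f := by
    rintro ⟨y, hy⟩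
    obtain ⟨c, rfl⟩ := Ideal.mem_span_singleton'.mp hy
    exact ⟨c, rfl⟩
  obtain ⟨s, hs⟩ := f.exists_rightInverse_of_surjective (LinearMap.range_eq_top.mpr hf)
  refine ⟨s ⟨a, Ideal.mem_span_singleton_self a⟩, ?_, fun x hx => ?_⟩
  · exact congr_arg Subtype.val (LinearMap.congr_fun hs ⟨a, Ideal.mem_span_singleton_self a⟩)
  · rw [← smul_eq_mul, ← map_smul]
    convert map_zero s
    exact Subtype.ext hx

/-- A domain in which every nonzero ideal divides a nonzero principal ideal is Dedekind. -/
theorem IsDedekindDomain.of_exists_mul_eq_span_singleton {R : Type*} [CommRing R] [IsDomain R]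
    (h : ∀ I : Ideal R, I ≠ ⊥ → ∃ a : R, a ≠ 0 ∧ ∃ J : Ideal R, I * J = Ideal.span {a}) :
    IsDedekindDomain R := by
  rw [isDedekindDomain_iff_mul_inv_cancel (K := FractionRing R)]
  intro I hI
  rw [FractionalIdeal.mul_inv_cancel_iff_isUnit]
  obtain ⟨b, I', hb, rfl⟩ := FractionalIdeal.exists_eq_spanSingleton_mul I
  have hI' : I' ≠ ⊥ := by
    rintro rfl
    exact hI (by simp)
  have isUnit_spanSingleton : ∀ x : FractionRing R, x ≠ 0 →
      IsUnit (FractionalIdeal.spanSingleton (nonZeroDivisors R) x) := fun x hx =>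
    IsUnit.of_mul_eq_one (FractionalIdeal.spanSingleton _ x⁻¹) (by
      rw [FractionalIdeal.spanSingleton_mul_spanSingleton, mul_inv_cancel₀ hx,
        FractionalIdeal.spanSingleton_one])
  have algebraMap_ne_zero : ∀ x : R, x ≠ 0 → algebraMap R (FractionRing R) x ≠ 0 := fun x hx =>
    (map_ne_zero_iff _ (IsFractionRing.injective R (FractionRing R))).mpr hx
  obtain ⟨a, ha, J, hJ⟩ := h I' hI'
  refine (isUnit_spanSingleton _ (inv_ne_zero (algebraMap_ne_zero b hb))).mul ?_
  refine isUnit_of_mul_isUnit_left (y := (J : FractionalIdeal (nonZeroDivisors R) _)) ?_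
  rw [← FractionalIdeal.coeIdeal_mul, hJ, FractionalIdeal.coeIdeal_span_singleton]
  exact isUnit_spanSingleton _ (algebraMap_ne_zero a ha)

theorem IsDedekindDomain.projective_ideal {R : Type*} [CommRing R] [IsDedekindDomain R]
    (I : Ideal R) : Module.Projective R I := by
  have := Module.finitePresentation_of_finite R I
  exact Module.Flat.projective_of_finitePresentation

theorem Module.Projective.restrictScalars_of_projective {R S M : Type*} [CommRing R] [CommRing S]
    [Algebra R S] [AddCommGroup M] [Module R M] [Module S M] [IsScalarTower R S M]
    [Module.Projective R S] [Module.Projective S M] : Module.Projective R M := by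
  classical
  obtain ⟨s, hs⟩ := Module.projective_def'.mp (inferInstance : Module.Projective S M)
  have : Module.Projective R (M →₀ S) :=
    .of_equiv' (finsuppLequivDFinsupp (ι := M) (M := S) R).symm
  refine .of_split (s.restrictScalars R) ((Finsupp.linearCombination S id).restrictScalars R) ?_
  ext x
  exact LinearMap.congr_fun hs x

theorem Ideal.projective_pi {ι : Type*} [Finite ι] {R : ι → Type*} [∀ i, CommRing (R i)]
    (h : ∀ i (J : Ideal (R i)), Module.Projective (R i) J) (I : Ideal (Π i, R i)) :
    Module.Projective (Π i, R i) I := by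
  classical
  have := Fintype.ofFinite ι
  let (i : ι) : Algebra (Π i, R i) (R i) := (Pi.evalRingHom R i).toAlgebra
  have hsurj (i : ι) : Function.Surjective (algebraMap (Π i, R i) (R i)) :=
    Function.surjective_eval i
  have hR (i : ι) : Module.Projective (Π i, R i) (R i) := by
    refine .of_split (M := Π i, R i)
      { toFun := Pi.single i
        map_add' := Pi.single_add i
        map_smul' := fun r x => ?_ } (Algebra.linearMap _ (R i)) ?_
    · exact Pi.single_mul_right x
    · ext
      exact Pi.single_eq_same i _
  let J (i : ι) : Ideal (R i) := I.map (algebraMap (Π i, R i) (R i))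
  have hJ (i : ι) : Module.Projective (Π i, R i) (J i) :=
    have := h i (J i)
    .restrictScalars_of_projective (S := R i)
  have hPi : Module.Projective (Π i, R i) (Π i, J i) :=
    .of_equiv' (DFinsupp.linearEquivFunOnFintype (R := Π i, R i) (M := fun i => J i))
  let e : I ≃ₗ[Π i, R i] Π i, J i :=
    { toFun := fun x i => ⟨x.1 i, Ideal.mem_map_of_mem (algebraMap (Π i, R i) (R i)) x.2⟩
      invFun := fun y => ⟨fun i => (y i).1, by
        rw [← Finset.univ_sum_single fun i => (y i).1]
        refine Submodule.sum_mem _ fun i _ => ?_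
        obtain ⟨x, hx, hxy⟩ := (Ideal.mem_map_iff_of_surjective _ (hsurj i)).mp (y i).2
        rw [← hxy, ← one_mul (algebraMap _ _ x)]
        exact (Pi.single_mul_left (f := x) (1 : R i)).symm ▸ I.mul_mem_left _ hx⟩
      map_add' := fun _ _ => rfl
      map_smul' := fun _ _ => rfl
      left_inv := fun _ => rfl
      right_inv := fun _ => rfl }
  exact .of_equiv' e.symm

theorem Ideal.projective_of_ringEquiv {R S : Type*} [CommRing R] [CommRing S] (e : R ≃+* S)
    (h : ∀ J : Ideal S, Module.Projective S J) (I : Ideal R) : Module.Projective R I := by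
  have := RingHomInvPair.of_ringEquiv e.symm
  have := RingHomInvPair.symm (e.symm : S →+* R) (e.symm.symm : R →+* S)
  have := h (Submodule.comap e.symm.toSemilinearEquiv.toLinearMap I)
  exact .of_equiv (e.symm.toSemilinearEquiv.ofSubmodule' I)

section MinimalPrimes

variable {R : Type*} [CommRing R]

theorem isReduced_of_projective_ideal (h : ∀ a : R, Module.Projective R (Ideal.span {a})) :
    IsReduced R := by
  refine isReduced_iff_pow_one_lt 2 one_lt_two |>.mpr fun a ha => ?_
  have := h a
  obtain ⟨u, hu, hu'⟩ := Ideal.exists_mul_eq_self_of_projective_span_singleton a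
  rw [← hu, mul_comm]
  exact hu' a (by rw [← sq, ha])

theorem Ideal.exists_mem_minimalPrimes_mul_eq_self
    (h : ∀ a : R, Module.Projective R (Ideal.span {a})) {P : Ideal R} (hP : P ∈ minimalPrimes R)
    {a : R} (ha : a ∈ P) : ∃ u ∈ P, u * a = a ∧ u * (1 - u) = 0 := by
  have := h a
  obtain ⟨u, hu, hu'⟩ := Ideal.exists_mul_eq_self_of_projective_span_singleton a
  have hidem : u * (1 - u) = 0 := by
    rw [mul_comm]
    exact hu' _ (by rw [sub_mul, hu, one_mul, sub_self])
  refine ⟨u, ?_, hu, hidem⟩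
  have : P.IsPrime := hP.1.1
  refine (this.mem_or_mem (hidem ▸ P.zero_mem)).resolve_right fun hu1 => ?_
  refine notMem_nonZeroDivisors_of_mem_mem_minimalPrimes (P.add_mem ha hu1) hP ?_
  rw [mem_nonZeroDivisors_iff_right]
  intro x hx
  have hxa : x * a = 0 := by linear_combination u * hx - x * hidem - x * hu
  have hxu := hu' x hxa
  linear_combination hx - hxa + hxu

theorem Ideal.isCoprime_of_mem_minimalPrimes
    (h : ∀ a : R, Module.Projective R (Ideal.span {a})) {P Q : Ideal R} (hP : P ∈ minimalPrimes R)
    (hQ : Q ∈ minimalPrimes R) (hPQ : P ≠ Q) : IsCoprime P Q := by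
  obtain ⟨a, haP, haQ⟩ := SetLike.not_le_iff_exists.mp fun hle =>
    hPQ (le_antisymm hle (hQ.2 ⟨hP.1.1, bot_le⟩ hle))
  obtain ⟨u, huP, hua, hidem⟩ := Ideal.exists_mem_minimalPrimes_mul_eq_self h hP haP
  have hQp : Q.IsPrime := hQ.1.1
  refine Ideal.isCoprime_iff_exists.mpr ⟨u, huP, 1 - u, ?_, by ring⟩
  exact (hQp.mem_or_mem (hidem ▸ Q.zero_mem)).resolve_left fun huQ =>
    haQ (hua ▸ Q.mul_mem_right a huQ)

end MinimalPrimes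

theorem Ideal.isDedekindDomain_quotient_of_projective {R : Type*} [CommRing R]
    (h : ∀ I : Ideal R, Module.Projective R I) (P : Ideal R) [P.IsPrime] :
    IsDedekindDomain (R ⧸ P) := by
  refine .of_exists_mul_eq_span_singleton fun I hI => ?_
  obtain ⟨b, hb, hb0⟩ := Submodule.exists_mem_ne_zero_of_ne_bot hI
  obtain ⟨a, rfl⟩ := Ideal.Quotient.mk_surjective b
  have := h (I.comap (Ideal.Quotient.mk P))
  obtain ⟨J, hJ⟩ := Ideal.exists_mul_eq_span_singleton_of_projective (a := a)
    (I.comap (Ideal.Quotient.mk P)) hb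
  refine ⟨_, hb0, J.map (Ideal.Quotient.mk P), ?_⟩
  rw [← Ideal.map_comap_of_surjective _ Ideal.Quotient.mk_surjective I, ← Ideal.map_mul, hJ,
    Ideal.map_span, Set.image_singleton]

/-- For a Noetherian commutative ring `A`, the following are equivalent:
(i) `A` is semi-hereditary; (ii) `A` is isomorphic to a finite product of
Dedekind domains; (iii) `A` is hereditary. -/
theorem stmt_14 (A : Type u) [CommRing A] [IsNoetherianRing A] :
    List.TFAE
      [∀ I : Ideal A, I.FG → Module.Projective A I,
       ∃ (n : ℕ) (I : Fin n → Ideal A),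
          Nonempty (A ≃+* ((i : Fin n) → A ⧸ I i)) ∧
            ∀ i : Fin n, IsDedekindDomain (A ⧸ I i),
       ∀ I : Ideal A, Module.Projective A I] := by
  tfae_have 1 → 2 := by
    intro h
    replace h (I : Ideal A) : Module.Projective A I := h I I.fg_of_isNoetherianRing
    have := (minimalPrimes.finite_of_isNoetherianRing A).to_subtype
    obtain ⟨n, ⟨e⟩⟩ := Finite.exists_equiv_fin (minimalPrimes A)
    have hred := isReduced_of_projective_ideal fun a => h (Ideal.span {a})
    have hinf : ⨅ i, (e.symm i : Ideal A) = ⊥ := by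
      rw [e.symm.iInf_comp (g := fun P : minimalPrimes A => (P : Ideal A)), ← sInf_eq_iInf',
        minimalPrimes, Ideal.sInf_minimalPrimes]
      exact nilradical_eq_bot_iff.mpr hred
    refine ⟨n, fun i => e.symm i, ⟨?_⟩, fun i => ?_⟩
    · refine (RingEquiv.quotientBot A).symm.trans ((Ideal.quotEquivOfEq hinf.symm).trans
        (Ideal.quotientInfRingEquivPiQuotient _ fun i j hij => ?_))
      exact Ideal.isCoprime_of_mem_minimalPrimes (fun a => h _) (e.symm i).2 (e.symm j).2
        fun heq => hij (e.symm.injective (Subtype.ext heq))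
    · have : (e.symm i : Ideal A).IsPrime := (e.symm i).2.1.1
      exact Ideal.isDedekindDomain_quotient_of_projective h _
  tfae_have 2 → 3 := by
    rintro ⟨n, I, ⟨e⟩, hI⟩
    exact Ideal.projective_of_ringEquiv e
      (Ideal.projective_pi fun i J => IsDedekindDomain.projective_ideal J)
  tfae_have 3 → 1 := fun h I _ => h I
  tfae_finish
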